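/- Let 0 < β ≤ 1/2. Then there exists a constant C > 0 such that for every n ∈ ℤ³ one has Σ ⟨n₁ + n₂⟩^{−2β} ⟨n₁⟩^{−2} ⟨n₂⟩^{−2} ⟨n₃⟩^{−2β − 4} ⟨n₄⟩^{−2β − 4} ≤ C ⟨n⟩^{−1 − 2β}, where the sum runs over all quadruples (n₁, n₂, n₃, n₄) ∈ (ℤ³)⁴ with n₁ + n₂ + n₃ + n₄ = n. -/

import Mathlib

noncomputable section

/-- Japanese bracket `⟨n⟩ = (1 + ‖n‖²)^{1/2}` of a lattice point `n ∈ ℤ³`. -/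
def jb (n : Fin 3 → ℤ) : ℝ :=
  Real.sqrt (1 + ∑ i, ((n i : ℝ)) ^ 2)

open scoped ENNReal

theorem tsum_natAbs_le (f : ℕ → ℝ≥0∞) : ∑' a : ℤ, f a.natAbs ≤ 2 * ∑' a, f a := by
  rw [tsum_of_nat_of_neg_add_one ENNReal.summable ENNReal.summable, two_mul]
  refine add_le_add (le_of_eq (by simp)) ?_
  have h : ∀ a : ℕ, (-((a : ℤ) + 1)).natAbs = a + 1 := fun a => by omega
  simp only [h]
  exact ENNReal.tsum_comp_le_tsum_of_injective (add_left_injective 1) f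

/-- A sum over `ℤ³` of the cube of a decreasing function of `|k|²` is at most the cube of a
one-dimensional sum. -/
theorem tsum_radial_le {g : ℝ → ℝ} (hg : AntitoneOn g (Set.Ici 0)) (hg0 : ∀ t, 0 ≤ t → 0 ≤ g t) :
    ∑' k : Fin 3 → ℤ, ENNReal.ofReal (g (∑ i, (k i : ℝ) ^ 2) ^ 3) ≤
      (2 * ∑' a : ℕ, ENNReal.ofReal (g ((a : ℝ) ^ 2))) ^ 3 := by
  set f : ℕ → ℝ≥0∞ := fun a => ENNReal.ofReal (g ((a : ℝ) ^ 2)) with hf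
  have hpt : ∀ k : Fin 3 → ℤ, ENNReal.ofReal (g (∑ i, (k i : ℝ) ^ 2) ^ 3) ≤
      f (k 0).natAbs * (f (k 1).natAbs * f (k 2).natAbs) := by
    intro k
    have hS : (0 : ℝ) ≤ ∑ i, (k i : ℝ) ^ 2 := Finset.sum_nonneg fun i _ => sq_nonneg _
    have h : ∀ i, ENNReal.ofReal (g (∑ i, (k i : ℝ) ^ 2)) ≤ f (k i).natAbs := by
      intro i
      have hc : (((k i).natAbs : ℝ)) ^ 2 = (k i : ℝ) ^ 2 := by
        rw [Nat.cast_natAbs, Int.cast_abs, sq_abs]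
      simp only [hf, hc]
      refine ENNReal.ofReal_le_ofReal (hg (Set.mem_Ici.2 (sq_nonneg _)) hS ?_)
      exact Finset.single_le_sum (f := fun i => (k i : ℝ) ^ 2) (fun i _ => sq_nonneg _)
        (Finset.mem_univ i)
    rw [ENNReal.ofReal_pow (hg0 _ hS), pow_three]
    exact mul_le_mul' (h 0) (mul_le_mul' (h 1) (h 2))
  calc _ ≤ ∑' k : Fin 3 → ℤ, f (k 0).natAbs * (f (k 1).natAbs * f (k 2).natAbs) :=
        ENNReal.tsum_le_tsum hpt
    _ ≤ ∑' p : ℤ × ℤ × ℤ, f p.1.natAbs * (f p.2.1.natAbs * f p.2.2.natAbs) := by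
        refine ENNReal.tsum_comp_le_tsum_of_injective
          (f := fun k : Fin 3 → ℤ => (k 0, k 1, k 2)) ?_
          (fun p : ℤ × ℤ × ℤ => f p.1.natAbs * (f p.2.1.natAbs * f p.2.2.natAbs))
        intro k l h
        simp only [Prod.mk.injEq] at h
        ext i
        fin_cases i
        exacts [h.1, h.2.1, h.2.2]
    _ = (∑' a : ℤ, f a.natAbs) ^ 3 := by
        simp only [ENNReal.tsum_prod', ENNReal.tsum_mul_left, ENNReal.tsum_mul_right, pow_three]
    _ ≤ _ := by gcongr; exact tsum_natAbs_le f

theorem jb_sq (k : Fin 3 → ℤ) : jb k ^ 2 = 1 + ∑ i, (k i : ℝ) ^ 2 :=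
  Real.sq_sqrt (add_nonneg zero_le_one (Finset.sum_nonneg fun _ _ => sq_nonneg _))

theorem one_le_jb (k : Fin 3 → ℤ) : 1 ≤ jb k :=
  Real.one_le_sqrt.2 (le_add_of_nonneg_right (Finset.sum_nonneg fun _ _ => sq_nonneg _))

theorem jb_pos (k : Fin 3 → ℤ) : 0 < jb k := one_pos.trans_le (one_le_jb k)

theorem jb_add_le {k l : Fin 3 → ℤ} (h : jb k ≤ jb l) : jb (k + l) ≤ 2 * jb l := by
  have hsq : jb k ^ 2 ≤ jb l ^ 2 := pow_le_pow_left₀ (jb_pos k).le h 2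
  refine le_of_sq_le_sq ?_ (by linarith [jb_pos l])
  have hS : ∑ i, ((k + l) i : ℝ) ^ 2 ≤ 2 * ∑ i, (k i : ℝ) ^ 2 + 2 * ∑ i, (l i : ℝ) ^ 2 := by
    rw [Finset.mul_sum, Finset.mul_sum, ← Finset.sum_add_distrib]
    refine Finset.sum_le_sum fun i _ => ?_
    simp only [Pi.add_apply, Int.cast_add]
    nlinarith [sq_nonneg ((k i : ℝ) - l i)]
  rw [mul_pow]
  rw [jb_sq] at *
  rw [jb_sq] at *
  linarith

theorem tsum_jb_rpow_ne_top {s : ℝ} (hs : 3 < s) :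
    ∑' k, ENNReal.ofReal (jb k ^ (-s)) ≠ ∞ := by
  set g : ℝ → ℝ := fun t => (1 + t) ^ (-(s / 6)) with hg
  have h1 : ∀ k, jb k ^ (-s) = g (∑ i, (k i : ℝ) ^ 2) ^ 3 := by
    intro k
    simp only [hg]
    rw [← jb_sq, ← Real.rpow_natCast, ← Real.rpow_natCast, ← Real.rpow_mul (jb_pos k).le,
      ← Real.rpow_mul (jb_pos k).le]
    congr 1
    push_cast
    ring
  simp only [h1]
  refine ne_top_of_le_ne_top ?_ (tsum_radial_le (g := g) ?_ ?_)
  · refine ENNReal.pow_ne_top (ENNReal.mul_ne_top (by simp) ?_)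
    have hsum : Summable fun a : ℕ => g ((a : ℝ) ^ 2) := by
      refine Summable.of_norm_bounded_eventually_nat
        (Real.summable_nat_rpow.2 (show -(s / 3) < -1 by linarith)) ?_
      filter_upwards [Filter.eventually_ge_atTop 1] with a ha
      have ha' : (0 : ℝ) < a := by exact_mod_cast ha
      rw [Real.norm_of_nonneg (Real.rpow_nonneg (by positivity) _)]
      calc (1 + (a : ℝ) ^ 2) ^ (-(s / 6)) ≤ ((a : ℝ) ^ 2) ^ (-(s / 6)) :=
            Real.rpow_le_rpow_of_nonpos (by positivity) (by linarith) (by linarith)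
        _ = (a : ℝ) ^ (-(s / 3)) := by
            rw [← Real.rpow_natCast, ← Real.rpow_mul ha'.le]
            congr 1
            push_cast
            ring
    exact hsum.tsum_ofReal_ne_top
  · intro x hx y hy hxy
    simp only [Set.mem_Ici] at hx hy
    exact Real.rpow_le_rpow_of_nonpos (by linarith) (by linarith) (by linarith)
  · intro t ht
    exact Real.rpow_nonneg (by linarith) _

/-- The discrete form of `∫ t^{-2/3} (R² + t²)^{-1/3} dt ≲ R^{-1/3}`. -/
theorem sum_range_le_of_cube {R r : ℝ} (hR : 1 ≤ R) (hr : 0 < r) (hrR : r ^ 3 = R) {h : ℕ → ℝ}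
    (hh : ∀ j, h j ^ 3 * ((1 + (j : ℝ) ^ 2) * (R ^ 2 + (j : ℝ) ^ 2)) = 1) (N : ℕ) :
    ∑ j ∈ Finset.range N, h j ≤ 24 / r := by
  set x : ℕ → ℝ := fun j => (j : ℝ) ^ (1 / 3 : ℝ) with hx
  have hx3 : ∀ j, x j ^ 3 = j := fun j => by
    simp only [hx]
    rw [← Real.rpow_natCast, ← Real.rpow_mul (by positivity)]
    norm_num
  have hx0 : ∀ j, 0 ≤ x j := fun j => by positivity
  have hxs : ∀ j, 0 < x (j + 1) := fun j => by positivity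
  have hxm : ∀ j, x j ≤ x (j + 1) := fun j =>
    Real.rpow_le_rpow (by positivity) (by push_cast; linarith) (by norm_num)
  have hd : ∀ j, 1 ≤ 3 * x (j + 1) ^ 2 * (x (j + 1) - x j) := fun j => by
    have h1 := hx3 j
    have h2 := hx3 (j + 1)
    push_cast at h2
    nlinarith [mul_nonneg (sq_nonneg (x (j + 1) - x j)) (hx0 j),
      mul_nonneg (sq_nonneg (x (j + 1) - x j)) (hxs j).le]
  have hle : ∀ (j : ℕ) (c : ℝ), 0 < c → 8 * (c ^ 3)⁻¹ * ((1 + (j : ℝ) ^ 2) * (R ^ 2 + (j : ℝ) ^ 2)) ≥ 1 →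
      h j ≤ 2 / c := by
    intro j c hc hge
    have hP : 0 < (1 + (j : ℝ) ^ 2) * (R ^ 2 + (j : ℝ) ^ 2) := by positivity
    refine le_of_pow_le_pow_left₀ three_ne_zero (by positivity) ?_
    refine le_of_mul_le_mul_right ?_ hP
    rw [hh j, div_pow, div_eq_mul_inv]
    linarith
  have hj1 : ∀ j : ℕ, x (j + 1) ^ 6 ≤ 2 * (1 + (j : ℝ) ^ 2) := fun j => by
    have : x (j + 1) ^ 6 = (x (j + 1) ^ 3) ^ 2 := by ring
    rw [this, hx3]
    push_cast
    nlinarith [sq_nonneg ((j : ℝ) - 1)]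
  have hnear : ∀ j, h j ≤ 6 / r ^ 2 * (x (j + 1) - x j) := by
    intro j
    have h1 : h j ≤ 2 / (x (j + 1) ^ 2 * r ^ 2) := by
      refine hle j _ (by have := hxs j; positivity) ?_
      have : (x (j + 1) ^ 2 * r ^ 2) ^ 3 = x (j + 1) ^ 6 * R ^ 2 := by rw [← hrR]; ring
      have hp := hxs j
      rw [this, ge_iff_le, ← div_eq_mul_inv, div_mul_eq_mul_div, one_le_div (by positivity)]
      have := mul_le_mul (hj1 j) (show R ^ 2 ≤ R ^ 2 + (j : ℝ) ^ 2 by nlinarith)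
        (by positivity) (by positivity)
      have hP : 0 < (1 + (j : ℝ) ^ 2) * (R ^ 2 + (j : ℝ) ^ 2) := by positivity
      linarith
    refine h1.trans ?_
    have hp := hxs j
    rw [div_le_iff₀ (by positivity)]
    have : 6 / r ^ 2 * (x (j + 1) - x j) * (x (j + 1) ^ 2 * r ^ 2) =
      2 * (3 * x (j + 1) ^ 2 * (x (j + 1) - x j)) := by field_simp; ring
    rw [this]
    linarith [hd j]
  have hfar : ∀ j, 0 < j → h j ≤ 6 * ((x j)⁻¹ - (x (j + 1))⁻¹) := by
    intro j hj
    have h1 : h j ≤ 2 / (x (j + 1) ^ 4) := by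
      refine hle j _ (by have := hxs j; positivity) ?_
      have hp := hxs j
      rw [ge_iff_le, ← div_eq_mul_inv, div_mul_eq_mul_div, one_le_div (by positivity)]
      have h3 : 1 + (j : ℝ) ^ 2 ≤ R ^ 2 + (j : ℝ) ^ 2 := by nlinarith
      have := mul_le_mul (hj1 j) ((hj1 j).trans (mul_le_mul_of_nonneg_left h3 zero_le_two))
        (by positivity) (by positivity)
      have hP : 0 < (1 + (j : ℝ) ^ 2) * (R ^ 2 + (j : ℝ) ^ 2) := by positivity
      have h4 : (x (j + 1) ^ 4) ^ 3 = x (j + 1) ^ 6 * x (j + 1) ^ 6 := by ring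
      linarith
    refine h1.trans ?_
    have hp := hxs j
    have hq : 0 < x j := by positivity
    rw [inv_sub_inv hq.ne' hp.ne', ← mul_div_assoc, div_le_div_iff₀ (by positivity) (by positivity)]
    have h5 : 6 * (x (j + 1) - x j) * x (j + 1) ^ 4 =
      2 * (3 * x (j + 1) ^ 2 * (x (j + 1) - x j)) * x (j + 1) ^ 2 := by ring
    rw [h5]
    have h6 : x j * x (j + 1) ≤ x (j + 1) ^ 2 := by nlinarith [hxm j]
    nlinarith [hd j, mul_nonneg (sub_nonneg.2 (hd j)) (sq_nonneg (x (j + 1)))]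
  have hnearsum : ∀ n, ∑ j ∈ Finset.range n, h j ≤ 6 / r ^ 2 * x n := by
    intro n
    refine (Finset.sum_le_sum fun j _ => hnear j).trans ?_
    rw [← Finset.mul_sum, Finset.sum_range_sub]
    gcongr
    linarith [hx0 0]
  set M := ⌈R⌉₊ with hM
  have hM1 : R ≤ M := Nat.le_ceil R
  have hM2 : (M : ℝ) ≤ 8 * R := by linarith [Nat.ceil_lt_add_one (show 0 ≤ R by linarith)]
  have hM0 : 0 < M := Nat.ceil_pos.2 (by linarith)
  have hxM1 : r ≤ x M := le_of_pow_le_pow_left₀ three_ne_zero (hx0 M) (by rw [hx3, hrR]; exact hM1)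
  have hxM2 : x M ≤ 2 * r :=
    le_of_pow_le_pow_left₀ three_ne_zero (by positivity) (by rw [hx3, mul_pow, hrR]; linarith)
  have hnearM : ∀ n, n ≤ M → ∑ j ∈ Finset.range n, h j ≤ 12 / r := by
    intro n hn
    have hxn : x n ≤ 2 * r := le_trans
      (Real.rpow_le_rpow (by positivity) (by exact_mod_cast hn) (by norm_num)) hxM2
    calc _ ≤ 6 / r ^ 2 * x n := hnearsum n
      _ ≤ 6 / r ^ 2 * (2 * r) := by gcongr
      _ = 12 / r := by field_simp; ring
  have h12 : 12 / r ≤ 24 / r := by gcongr; norm_num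
  rcases le_total N M with hN | hN
  · exact (hnearM N hN).trans h12
  · have hsum : ∀ n, M ≤ n →
        ∑ j ∈ Finset.range n, h j ≤ 12 / r + 6 * ((x M)⁻¹ - (x n)⁻¹) := by
      intro n hn
      induction n, hn using Nat.le_induction with
      | base => simpa using hnearM M le_rfl
      | succ n hn ih =>
        rw [Finset.sum_range_succ]
        linarith [hfar n (hM0.trans_le hn)]
    have h1 : (x M)⁻¹ ≤ r⁻¹ := inv_anti₀ hr hxM1
    have h2 : 0 ≤ (x N)⁻¹ := inv_nonneg.2 (hx0 N)
    have h3 : 24 / r = 12 / r + 12 * r⁻¹ := by rw [div_eq_mul_inv, div_eq_mul_inv]; ring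
    have h4 : 0 < r⁻¹ := inv_pos.2 hr
    rw [h3]
    linarith [hsum N hN]

theorem exists_tsum_jb_sq_convolution_le : ∃ C : ℝ≥0∞, C ≠ ∞ ∧ ∀ m : Fin 3 → ℤ,
    ∑' k, ENNReal.ofReal (jb k ^ (-(2 : ℝ))) * ENNReal.ofReal (jb (m - k) ^ (-(2 : ℝ))) ≤
      C * ENNReal.ofReal (jb m ^ (-(1 : ℝ))) := by
  refine ⟨ENNReal.ofReal (16 * 48 ^ 3), ENNReal.ofReal_ne_top, fun m => ?_⟩
  set R := jb m with hRdef
  have hR : 1 ≤ R := one_le_jb m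
  have hR0 : 0 < R := jb_pos m
  set r := R ^ (1 / 3 : ℝ) with hrdef
  have hr : 0 < r := Real.rpow_pos_of_pos hR0 _
  have hrR : r ^ 3 = R := by
    rw [hrdef, ← Real.rpow_natCast, ← Real.rpow_mul hR0.le]
    norm_num
  set g : ℝ → ℝ := fun t => ((1 + t) * (R ^ 2 + t)) ^ (-(1 / 3) : ℝ) with hg
  have hg0 : ∀ t, 0 ≤ t → 0 ≤ g t := fun t ht => Real.rpow_nonneg (by positivity) _
  have hganti : AntitoneOn g (Set.Ici 0) := by
    intro x hx y hy hxy
    simp only [Set.mem_Ici] at hx hy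
    refine Real.rpow_le_rpow_of_nonpos (by positivity) ?_ (by norm_num)
    gcongr
  have hg3 : ∀ t, 0 ≤ t → g t ^ 3 = ((1 + t) * (R ^ 2 + t))⁻¹ := by
    intro t ht
    simp only [hg]
    rw [← Real.rpow_natCast, ← Real.rpow_mul (by positivity), ← Real.rpow_neg_one]
    norm_num
  set F : (Fin 3 → ℤ) → ℝ≥0∞ := fun k => ENNReal.ofReal (g (∑ i, (k i : ℝ) ^ 2) ^ 3) with hF
  have hFsum : ∑' k, F k ≤ ENNReal.ofReal (48 ^ 3 / R) := by
    refine (tsum_radial_le hganti hg0).trans ?_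
    have h1 : ∑' a : ℕ, ENNReal.ofReal (g ((a : ℝ) ^ 2)) ≤ ENNReal.ofReal (24 / r) := by
      refine ENNReal.tsum_le_of_sum_range_le fun N => ?_
      rw [← ENNReal.ofReal_sum_of_nonneg fun j _ => hg0 _ (sq_nonneg _)]
      refine ENNReal.ofReal_le_ofReal (sum_range_le_of_cube hR hr hrR (fun j => ?_) N)
      rw [hg3 _ (sq_nonneg _)]
      exact inv_mul_cancel₀ (by positivity)
    calc _ ≤ (2 * ENNReal.ofReal (24 / r)) ^ 3 := by gcongr
      _ = ENNReal.ofReal ((2 * (24 / r)) ^ 3) := by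
          rw [ENNReal.ofReal_pow (by positivity), ENNReal.ofReal_mul zero_le_two,
            ENNReal.ofReal_ofNat]
      _ = ENNReal.ofReal (48 ^ 3 / R) := by
          rw [← hrR]
          congr 1
          ring
  have hmain : ∀ k l : Fin 3 → ℤ, k + l = m → jb k ≤ jb l →
      ENNReal.ofReal (jb k ^ (-(2 : ℝ))) * ENNReal.ofReal (jb l ^ (-(2 : ℝ))) ≤ 8 * F k := by
    intro k l hkl hle
    have hk := jb_pos k
    have hl := jb_pos l
    have hS : (0 : ℝ) ≤ ∑ i, (k i : ℝ) ^ 2 := Finset.sum_nonneg fun i _ => sq_nonneg _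
    have hRl : R ≤ 2 * jb l := hRdef ▸ hkl ▸ jb_add_le hle
    have h8 : (8 : ℝ≥0∞) = ENNReal.ofReal 8 := (ENNReal.ofReal_ofNat 8).symm
    rw [← ENNReal.ofReal_mul (by positivity), hF, h8, ← ENNReal.ofReal_mul (by norm_num), hg3 _ hS,
      ← jb_sq]
    refine ENNReal.ofReal_le_ofReal ?_
    rw [Real.rpow_neg hk.le, Real.rpow_neg hl.le, Real.rpow_two, Real.rpow_two, ← mul_inv,
      ← div_eq_mul_inv, le_div_iff₀ (by positivity), ← div_eq_inv_mul, div_le_iff₀ (by positivity)]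
    have h1 : R ^ 2 + ∑ i, (k i : ℝ) ^ 2 ≤ 8 * jb l ^ 2 := by nlinarith [jb_sq k]
    nlinarith [mul_le_mul_of_nonneg_left h1 (sq_nonneg (jb k))]
  have hpt : ∀ k : Fin 3 → ℤ,
      ENNReal.ofReal (jb k ^ (-(2 : ℝ))) * ENNReal.ofReal (jb (m - k) ^ (-(2 : ℝ))) ≤
        8 * F k + 8 * F (m - k) := by
    intro k
    rcases le_total (jb k) (jb (m - k)) with h | h
    · exact (hmain k (m - k) (by abel) h).trans le_self_add
    · rw [mul_comm]
      exact (hmain (m - k) k (by abel) h).trans le_add_self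
  have hrefl : ∑' k, F (m - k) = ∑' k, F k := (Equiv.subLeft m).tsum_eq F
  calc _ ≤ ∑' k, (8 * F k + 8 * F (m - k)) := ENNReal.tsum_le_tsum hpt
    _ = 16 * ∑' k, F k := by
        rw [ENNReal.tsum_add, ENNReal.tsum_mul_left, ENNReal.tsum_mul_left, hrefl, ← add_mul]
        norm_num
    _ ≤ 16 * ENNReal.ofReal (48 ^ 3 / R) := by gcongr
    _ = _ := by
        rw [← ENNReal.ofReal_mul (by norm_num), Real.rpow_neg_one, ← ENNReal.ofReal_ofNat 16,
          ← ENNReal.ofReal_mul (by norm_num), div_eq_mul_inv, mul_assoc]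

theorem exists_tsum_jb_rpow_convolution_le {s : ℝ} (hs : 0 < s) : ∃ C : ℝ≥0∞, C ≠ ∞ ∧
    ∀ m : Fin 3 → ℤ,
      ∑' k, ENNReal.ofReal (jb k ^ (-s)) * ENNReal.ofReal (jb (m - k) ^ (-(s + 3))) ≤
        C * ENNReal.ofReal (jb m ^ (-s)) := by
  set J : (Fin 3 → ℤ) → ℝ≥0∞ := fun k => ENNReal.ofReal (jb k ^ (-(s + 3))) with hJ
  have hT : ∑' k, J k ≠ ∞ := tsum_jb_rpow_ne_top (by linarith)
  refine ⟨ENNReal.ofReal (2 ^ s) * (2 * ∑' k, J k),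
    ENNReal.mul_ne_top ENNReal.ofReal_ne_top (ENNReal.mul_ne_top (by simp) hT), fun m => ?_⟩
  have hdom : ∀ k : Fin 3 → ℤ, jb m ≤ 2 * jb k → jb k ^ (-s) ≤ 2 ^ s * jb m ^ (-s) := by
    intro k h
    have hk := jb_pos k
    calc jb k ^ (-s) = 2 ^ s * (2 * jb k) ^ (-s) := by
          rw [Real.mul_rpow zero_le_two hk.le, ← mul_assoc, ← Real.rpow_add two_pos]
          simp
      _ ≤ 2 ^ s * jb m ^ (-s) := by
          gcongr ?_ * ?_
          exact Real.rpow_le_rpow_of_nonpos (jb_pos m) h (by linarith)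
  have hpt : ∀ k, ENNReal.ofReal (jb k ^ (-s)) * J (m - k) ≤
      ENNReal.ofReal (2 ^ s) * ENNReal.ofReal (jb m ^ (-s)) * (J k + J (m - k)) := by
    intro k
    set l := m - k with hl
    have hkl : k + l = m := by rw [hl]; abel
    have hk := jb_pos k
    have hl0 := jb_pos l
    have hm := jb_pos m
    simp only [hJ]
    rw [← ENNReal.ofReal_mul (by positivity), ← ENNReal.ofReal_mul (by positivity),
      ← ENNReal.ofReal_add (by positivity) (by positivity), ← ENNReal.ofReal_mul (by positivity)]
    refine ENNReal.ofReal_le_ofReal ?_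
    have hadd : ∀ q : Fin 3 → ℤ, jb q ^ (-(s + 3)) = jb q ^ (-s) * jb q ^ (-(3 : ℝ)) := by
      intro q
      rw [← Real.rpow_add (jb_pos q)]
      congr 1
      ring
    rcases le_total (jb l) (jb k) with h | h
    · have h1 := hdom k (by rw [← hkl, add_comm]; exact jb_add_le h)
      refine mul_le_mul h1 ?_ (by positivity) (by positivity)
      exact le_add_of_nonneg_left (by positivity)
    · have h1 := hdom l (by rw [← hkl]; exact jb_add_le h)
      have h2 : jb l ^ (-(3 : ℝ)) ≤ jb k ^ (-(3 : ℝ)) :=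
        Real.rpow_le_rpow_of_nonpos hk h (by norm_num)
      calc jb k ^ (-s) * jb l ^ (-(s + 3)) = jb l ^ (-s) * (jb k ^ (-s) * jb l ^ (-(3 : ℝ))) := by
            rw [hadd l]; ring
        _ ≤ 2 ^ s * jb m ^ (-s) * (jb k ^ (-s) * jb k ^ (-(3 : ℝ))) := by gcongr
        _ ≤ _ := by
            rw [← hadd k]
            gcongr
            exact le_add_of_nonneg_right (by positivity)
  have hrefl : ∑' k, J (m - k) = ∑' k, J k := (Equiv.subLeft m).tsum_eq J
  refine (ENNReal.tsum_le_tsum hpt).trans (le_of_eq ?_)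
  rw [ENNReal.tsum_mul_left, ENNReal.tsum_add, hrefl]
  ring

theorem exists_hasSum_le_of_tsum_ofReal_le {ι : Type*} {f : ι → ℝ} (hf : ∀ i, 0 ≤ f i) {K : ℝ}
    (hK : 0 ≤ K) (h : ∑' i, ENNReal.ofReal (f i) ≤ ENNReal.ofReal K) :
    ∃ L, HasSum f L ∧ L ≤ K := by
  have hne : ∑' i, ENNReal.ofReal (f i) ≠ ∞ := ne_top_of_le_ne_top ENNReal.ofReal_ne_top h
  refine ⟨_, ?_, ENNReal.toReal_le_of_le_ofReal hK h⟩
  have hsum := ENNReal.hasSum_toReal hne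
  rw [← ENNReal.tsum_toReal_eq fun _ => ENNReal.ofReal_ne_top] at hsum
  simpa only [ENNReal.toReal_ofReal (hf _)] using hsum

theorem quadruple_convolution_bound (β : ℝ) (hβ0 : 0 < β) (hβ : β ≤ 1 / 2) :
    ∃ C : ℝ, 0 < C ∧ ∀ n : Fin 3 → ℤ, ∃ L : ℝ,
      HasSum (fun p : {q : (Fin 3 → ℤ) × (Fin 3 → ℤ) × (Fin 3 → ℤ) × (Fin 3 → ℤ) //
          q.1 + q.2.1 + q.2.2.1 + q.2.2.2 = n} =>
        jb (p.1.1 + p.1.2.1) ^ (-(2 * β)) * jb p.1.1 ^ (-(2 : ℝ)) *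
          jb p.1.2.1 ^ (-(2 : ℝ)) * jb p.1.2.2.1 ^ (-(2 * β + 4)) *
          jb p.1.2.2.2 ^ (-(2 * β + 4))) L ∧
      L ≤ C * jb n ^ (-(1 + 2 * β)) := by
  obtain ⟨A, hA, hconvA⟩ := exists_tsum_jb_sq_convolution_le
  obtain ⟨B, hB, hconvB⟩ := exists_tsum_jb_rpow_convolution_le (s := 1 + 2 * β) (by linarith)
  have hABB : A * B * B ≠ ∞ := ENNReal.mul_ne_top (ENNReal.mul_ne_top hA hB) hB
  refine ⟨(A * B * B).toReal + 1, by positivity, fun n => ?_⟩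
  have hn := jb_pos n
  refine exists_hasSum_le_of_tsum_ofReal_le (fun p => ?_) (by positivity) ?_
  · have := jb_pos (p.1.1 + p.1.2.1)
    have := jb_pos p.1.1
    have := jb_pos p.1.2.1
    have := jb_pos p.1.2.2.1
    have := jb_pos p.1.2.2.2
    positivity
  set J : ℝ → (Fin 3 → ℤ) → ℝ≥0∞ := fun s k => ENNReal.ofReal (jb k ^ (-s)) with hJ
  have hJadd : ∀ m, J (2 * β) m * J 1 m = J (1 + 2 * β) m := fun m => by
    simp only [hJ]
    rw [← ENNReal.ofReal_mul (Real.rpow_nonneg (jb_pos m).le _), ← Real.rpow_add (jb_pos m)]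
    congr 2
    ring
  have hexp : 2 * β + 4 = 1 + 2 * β + 3 := by ring
  set G : (Fin 3 → ℤ) × (Fin 3 → ℤ) × (Fin 3 → ℤ) → ℝ≥0∞ := fun p =>
    J (1 + 2 * β + 3) (n - p.1) * (J (1 + 2 * β + 3) (p.1 - p.2.1) *
      (J (2 * β) p.2.1 * (J 2 p.2.2 * J 2 (p.2.1 - p.2.2)))) with hG
  set e : {q : (Fin 3 → ℤ) × (Fin 3 → ℤ) × (Fin 3 → ℤ) × (Fin 3 → ℤ) //
      q.1 + q.2.1 + q.2.2.1 + q.2.2.2 = n} → (Fin 3 → ℤ) × (Fin 3 → ℤ) × (Fin 3 → ℤ) :=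
    fun p => (p.1.1 + p.1.2.1 + p.1.2.2.1, p.1.1 + p.1.2.1, p.1.1) with he
  have hinj : Function.Injective e := by
    rintro ⟨⟨a, b, c, d⟩, hp⟩ ⟨⟨a', b', c', d'⟩, hq⟩ h
    simp only [he, Prod.mk.injEq] at h hp hq
    obtain ⟨h1, h2, rfl⟩ := h
    obtain rfl := add_left_cancel h2
    obtain rfl := add_left_cancel h1
    obtain rfl := add_left_cancel (hp.trans hq.symm)
    rfl
  calc _ = ∑' p, G (e p) := by
        refine tsum_congr fun p => ?_
        obtain ⟨⟨a, b, c, d⟩, hp⟩ := p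
        have h1 : n - (a + b + c) = d := by rw [← hp]; simp
        have h2 : a + b + c - (a + b) = c := by simp
        have h3 : a + b - a = b := by simp
        have hr : ∀ (k : Fin 3 → ℤ) (t : ℝ), 0 ≤ jb k ^ t :=
          fun k t => Real.rpow_nonneg (jb_pos k).le t
        simp only [hG, he, h1, h2, h3, hJ, hexp]
        rw [ENNReal.ofReal_mul' (hr _ _), ENNReal.ofReal_mul' (hr _ _),
          ENNReal.ofReal_mul' (hr _ _), ENNReal.ofReal_mul' (hr _ _)]
        ring
    _ ≤ ∑' p, G p := ENNReal.tsum_comp_le_tsum_of_injective hinj G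
    _ = ∑' l, J (1 + 2 * β + 3) (n - l) * ∑' m, J (1 + 2 * β + 3) (l - m) *
          (J (2 * β) m * ∑' k, J 2 k * J 2 (m - k)) := by
        simp only [hG, ENNReal.tsum_prod', ENNReal.tsum_mul_left]
    _ ≤ ∑' l, J (1 + 2 * β + 3) (n - l) * ∑' m, J (1 + 2 * β + 3) (l - m) *
          (J (2 * β) m * (A * J 1 m)) := by
        gcongr with l m
        exact hconvA m
    _ = ∑' l, J (1 + 2 * β + 3) (n - l) * (A * ∑' m, J (1 + 2 * β) m *
          J (1 + 2 * β + 3) (l - m)) := by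
        simp only [← ENNReal.tsum_mul_left (a := A), ← hJadd]
        congr! 5
        ring
    _ ≤ ∑' l, J (1 + 2 * β + 3) (n - l) * (A * (B * J (1 + 2 * β) l)) := by
        gcongr with l
        exact hconvB l
    _ = A * B * ∑' l, J (1 + 2 * β) l * J (1 + 2 * β + 3) (n - l) := by
        rw [← ENNReal.tsum_mul_left]
        congr! 2
        ring
    _ ≤ A * B * (B * J (1 + 2 * β) n) := by
        gcongr
        exact hconvB n
    _ = ENNReal.ofReal (A * B * B).toReal * J (1 + 2 * β) n := by
        rw [ENNReal.ofReal_toReal hABB]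
        ring
    _ ≤ _ := by
        rw [← ENNReal.ofReal_mul ENNReal.toReal_nonneg]
        gcongr
        linarith

end
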